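/- arXiv:1901.11166 — 5 statements merged into one kernel-verified Lean document; each statement's English description precedes it below -/
import Mathlib

section
/- With the notation of the c-map setup, for every A ∈ {1,…,n} the following identity holds in ℂ: z^A/z⁰ + ((x⁰ + r⁰)/(2r⁰))·χ^A + ((x⁰ − r⁰)/(2r⁰))·χ̄^A = (x⃗⁰ · x⃗^A)/(x⃗⁰ · x⃗⁰), where the real right-hand side is regarded as a complex number. -/
/-- Standard dot product on `ℝ³`. -/
noncomputable def dot3 (a b : Fin 3 → ℝ) : ℝ := ∑ i, a i * b i

/-- Standard cross product on `ℝ³`. -/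
noncomputable def cross3 (a b : Fin 3 → ℝ) : Fin 3 → ℝ :=
  ![a 1 * b 2 - a 2 * b 1, a 2 * b 0 - a 0 * b 2, a 0 * b 1 - a 1 * b 0]

/-- The underlying field identity, with `w` and `W` in the role of the conjugates of `z` and `Z`. -/
theorem cmap_field_identity {K : Type*} [Field K] [CharZero K] {x r z w : K} (X Z W : K)
    (hr : r ≠ 0) (hw : w ≠ 0) (hm : x - r ≠ 0) (hp : x + r ≠ 0)
    (h : 4 * z * w = r ^ 2 - x ^ 2) :
    Z / z + (x + r) / (2 * r) * ((Z / ((x - r) / (2 * w)) + X - W * ((x - r) / (2 * w))) / r)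
        + (x - r) / (2 * r) * ((Z / ((x + r) / (2 * w)) + X - W * ((x + r) / (2 * w))) / r)
      = (x * X + 2 * z * W + 2 * w * Z) / r ^ 2 := by
  obtain rfl : z = -((x - r) * (x + r)) / (4 * w) := by
    field_simp
    linear_combination h
  field_simp
  ring

/-- the identity
`z^A/z⁰ + ((x⁰+r⁰)/(2r⁰))χ^A + ((x⁰−r⁰)/(2r⁰))χ̄^A = (x⃗⁰·x⃗^A)/(x⃗⁰·x⃗⁰)`
in the c-map setup (components `1,2,3` of the paper are `0,1,2` in `Fin 3`). -/
theorem stmt12 (n : ℕ) (hn : 1 ≤ n) (xv : Fin (n + 1) → Fin 3 → ℝ)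
    (x : Fin (n + 1) → ℝ) (hx : ∀ I, x I = xv I 0)
    (z : Fin (n + 1) → ℂ)
    (hz : ∀ I, z I = (1 / 2 : ℂ) * ((xv I 1 : ℂ) + Complex.I * (xv I 2 : ℂ)))
    (hz0 : z 0 ≠ 0)
    (r : ℝ) (hr : r = Real.sqrt (dot3 (xv 0) (xv 0)))
    (ζp ζm : ℂ)
    (hζp : ζp = ((x 0 : ℂ) - (r : ℂ)) / (2 * starRingEnd ℂ (z 0)))
    (hζm : ζm = ((x 0 : ℂ) + (r : ℂ)) / (2 * starRingEnd ℂ (z 0)))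
    (χ χb : Fin (n + 1) → ℂ)
    (hχ : ∀ A, χ A = (z A / ζp + (x A : ℂ) - starRingEnd ℂ (z A) * ζp) / (r : ℂ))
    (hχb : ∀ A, χb A = (z A / ζm + (x A : ℂ) - starRingEnd ℂ (z A) * ζm) / (r : ℂ)) :
    ∀ A : Fin (n + 1), A ≠ 0 →
      z A / z 0 + (((x 0 : ℂ) + (r : ℂ)) / (2 * (r : ℂ))) * χ A
          + (((x 0 : ℂ) - (r : ℂ)) / (2 * (r : ℂ))) * χb A
        = ((dot3 (xv 0) (xv A) / dot3 (xv 0) (xv 0) : ℝ) : ℂ) := by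
  intro A _
  have hconj : ∀ I, starRingEnd ℂ (z I)
      = (1 / 2 : ℂ) * ((xv I 1 : ℂ) - Complex.I * (xv I 2 : ℂ)) := fun I => by
    rw [hz]
    simp [sub_eq_add_neg, Complex.conj_ofNat]
  have hw : starRingEnd ℂ (z 0) ≠ 0 := (map_ne_zero _).mpr hz0
  have hr2 : r ^ 2 = dot3 (xv 0) (xv 0) := by
    rw [hr, Real.sq_sqrt]
    exact Finset.sum_nonneg fun i _ => mul_self_nonneg _
  have hr2c : (r : ℂ) ^ 2 = (dot3 (xv 0) (xv 0) : ℝ) := by exact_mod_cast hr2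
  have h : 4 * z 0 * starRingEnd ℂ (z 0) = (r : ℂ) ^ 2 - (x 0 : ℂ) ^ 2 := by
    rw [hr2c, hconj, hz, hx]
    simp only [dot3, Fin.sum_univ_three]
    push_cast
    linear_combination -(xv 0 2 : ℂ) ^ 2 * Complex.I_sq
  have hprod : ((x 0 : ℂ) - r) * ((x 0 : ℂ) + r) ≠ 0 := by
    have h4 : 4 * z 0 * starRingEnd ℂ (z 0) ≠ 0 := by simp [hz0]
    intro h0
    exact h4 (by linear_combination h - h0)
  have hrne : (r : ℂ) ≠ 0 := by
    have hpos : 0 < Complex.normSq (z 0) := Complex.normSq_pos.mpr hz0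
    have hreal : 4 * Complex.normSq (z 0) = r ^ 2 - x 0 ^ 2 := by
      rw [mul_assoc, Complex.mul_conj] at h
      exact_mod_cast h
    rw [Complex.ofReal_ne_zero]
    rintro rfl
    nlinarith [sq_nonneg (x 0)]
  rw [hχ, hχb, hζp, hζm, cmap_field_identity _ _ _ hrne hw (left_ne_zero_of_mul hprod)
    (right_ne_zero_of_mul hprod) h, Complex.ofReal_div, ← hr2c]
  congr 1
  rw [hconj, hconj, hz, hz, hx, hx]
  simp only [dot3, Fin.sum_univ_three]
  push_cast
  linear_combination -(xv 0 2 : ℂ) * (xv A 2 : ℂ) * Complex.I_sq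
end

section
/- With the notation of the c-map setup, for all A, B ∈ {1,…,n} the following identity holds in ℂ: χ^A · χ̄^B = [ (x⃗⁰ × x⃗^A) · (x⃗⁰ × x⃗^B) − i · r⁰ · ( x⃗⁰ · (x⃗^A × x⃗^B) ) ] / ( 4 |z⁰|² · (r⁰)² ), where the real quantities on the right are regarded as complex numbers. -/
/-- The polynomial identity behind the product formula: `w, a, b` are the complex coordinates built
from the last two components of three vectors, and `v, a', b'` are their conjugates. -/
lemma chi_numerator_identity (t r w v s a a' u b b' : ℂ) (hr : r ^ 2 = t ^ 2 + 4 * w * v) :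
    (-(t + r) * a * v + 2 * w * v * s - a' * w * (t - r)) *
      (-(t - r) * b * v + 2 * w * v * u - b' * w * (t + r)) =
    w * v * ((t ^ 2 + 4 * w * v) * (s * u + 2 * (a * b' + a' * b))
      - (t * s + 2 * (w * a' + v * a)) * (t * u + 2 * (w * b' + v * b))
      + 2 * r * (t * (a * b' - a' * b) + s * (v * b - w * b') + u * (w * a' - v * a))) := by
  linear_combination (-(a * v - a' * w) * (b * v - b' * w)) * hr

/-- the identity
`χ^A χ̄^B = [(x⃗⁰×x⃗^A)·(x⃗⁰×x⃗^B) − i r⁰ (x⃗⁰·(x⃗^A×x⃗^B))] / (4|z⁰|²(r⁰)²)`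
in the c-map setup (components `1,2,3` of the paper are `0,1,2` in `Fin 3`). -/
theorem stmt13 (n : ℕ) (hn : 1 ≤ n) (xv : Fin (n + 1) → Fin 3 → ℝ)
    (x : Fin (n + 1) → ℝ) (hx : ∀ I, x I = xv I 0)
    (z : Fin (n + 1) → ℂ)
    (hz : ∀ I, z I = (1 / 2 : ℂ) * ((xv I 1 : ℂ) + Complex.I * (xv I 2 : ℂ)))
    (hz0 : z 0 ≠ 0)
    (r : ℝ) (hr : r = Real.sqrt (dot3 (xv 0) (xv 0)))
    (ζp ζm : ℂ)
    (hζp : ζp = ((x 0 : ℂ) - (r : ℂ)) / (2 * starRingEnd ℂ (z 0)))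
    (hζm : ζm = ((x 0 : ℂ) + (r : ℂ)) / (2 * starRingEnd ℂ (z 0)))
    (χ χb : Fin (n + 1) → ℂ)
    (hχ : ∀ A, χ A = (z A / ζp + (x A : ℂ) - starRingEnd ℂ (z A) * ζp) / (r : ℂ))
    (hχb : ∀ A, χb A = (z A / ζm + (x A : ℂ) - starRingEnd ℂ (z A) * ζm) / (r : ℂ)) :
    ∀ A B : Fin (n + 1), A ≠ 0 → B ≠ 0 →
      χ A * χb B =
        (((dot3 (cross3 (xv 0) (xv A)) (cross3 (xv 0) (xv B)) : ℝ) : ℂ)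
            - Complex.I * (r : ℂ) * ((dot3 (xv 0) (cross3 (xv A) (xv B)) : ℝ) : ℂ))
          / ((4 * Complex.normSq (z 0) * r ^ 2 : ℝ) : ℂ) := by
  intro A B _ _
  have hconj (I : Fin (n + 1)) : starRingEnd ℂ (z I) =
      (1 / 2 : ℂ) * ((xv I 1 : ℂ) - Complex.I * (xv I 2 : ℂ)) := by
    apply Complex.ext <;> simp [hz]
  have hI : Complex.I ^ 2 = -1 := Complex.I_sq
  have hv0 : starRingEnd ℂ (z 0) ≠ 0 := by simpa using hz0
  have hns : (Complex.normSq (z 0) : ℂ) = z 0 * starRingEnd ℂ (z 0) :=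
    (Complex.mul_conj _).symm
  have hdot (I J : Fin (n + 1)) : ((dot3 (xv I) (xv J) : ℝ) : ℂ) =
      x I * x J + 2 * (z I * starRingEnd ℂ (z J) + starRingEnd ℂ (z I) * z J) := by
    rw [hconj, hconj, hz, hz, hx, hx]
    simp only [dot3, Fin.sum_univ_three]
    push_cast
    linear_combination ((xv I 2 : ℂ) * xv J 2) * hI
  have hr2 : (r : ℂ) ^ 2 = (x 0 : ℂ) ^ 2 + 4 * z 0 * starRingEnd ℂ (z 0) := by
    have h : r ^ 2 = dot3 (xv 0) (xv 0) := by
      rw [hr, Real.sq_sqrt]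
      exact Finset.sum_nonneg fun i _ => mul_self_nonneg _
    have h' := congrArg (fun y : ℝ => (y : ℂ)) h
    simp only [hdot] at h'
    push_cast at h'
    linear_combination h'
  have hcross : ((dot3 (cross3 (xv 0) (xv A)) (cross3 (xv 0) (xv B)) : ℝ) : ℂ) =
      (dot3 (xv 0) (xv 0) : ℂ) * dot3 (xv A) (xv B)
        - dot3 (xv 0) (xv A) * dot3 (xv 0) (xv B) := by
    simp only [dot3, cross3, Fin.sum_univ_three, Matrix.cons_val]
    push_cast
    ring
  have htriple : Complex.I * ((dot3 (xv 0) (cross3 (xv A) (xv B)) : ℝ) : ℂ) =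
      -2 * (x 0 * (z A * starRingEnd ℂ (z B) - starRingEnd ℂ (z A) * z B)
        + x A * (starRingEnd ℂ (z 0) * z B - z 0 * starRingEnd ℂ (z B))
        + x B * (z 0 * starRingEnd ℂ (z A) - starRingEnd ℂ (z 0) * z A)) := by
    rw [hconj, hconj, hconj, hz, hz, hz]
    simp only [hx, dot3, cross3, Fin.sum_univ_three, Matrix.cons_val]
    push_cast
    ring
  have hfac : ((x 0 : ℂ) - r) * (x 0 + r) = -(4 * z 0 * starRingEnd ℂ (z 0)) := by
    linear_combination -hr2
  have hprod : ((x 0 : ℂ) - r) * (x 0 + r) ≠ 0 := by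
    rw [hfac]
    simp [hz0]
  have hm : (x 0 : ℂ) - r ≠ 0 := left_ne_zero_of_mul hprod
  have hp : (x 0 : ℂ) + r ≠ 0 := right_ne_zero_of_mul hprod
  have hζp_inv : ζp⁻¹ = -((x 0 : ℂ) + r) / (2 * z 0) := by
    rw [hζp, inv_div, div_eq_div_iff hm (by simpa using hz0)]
    linear_combination hfac
  have hζm_inv : ζm⁻¹ = -((x 0 : ℂ) - r) / (2 * z 0) := by
    rw [hζm, inv_div, div_eq_div_iff hp (by simpa using hz0)]
    linear_combination hfac
  have hr0 : (r : ℂ) ≠ 0 := by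
    intro h
    have hd : dot3 (xv 0) (xv 0) = Complex.normSq (z 0) * 4 + x 0 ^ 2 := by
      apply Complex.ofReal_injective
      rw [hdot]
      push_cast
      rw [hns]
      ring
    have hpos : 0 < r := by
      rw [hr, Real.sqrt_pos, hd]
      have := Complex.normSq_pos.mpr hz0
      positivity
    exact hpos.ne' (by exact_mod_cast h)
  have key := chi_numerator_identity (x 0) r (z 0) (starRingEnd ℂ (z 0)) (x A) (z A)
    (starRingEnd ℂ (z A)) (x B) (z B) (starRingEnd ℂ (z B)) hr2
  rw [hχ, hχb, div_eq_mul_inv (z A), div_eq_mul_inv (z B), hζp_inv, hζm_inv, hζp, hζm, hcross,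
    mul_right_comm Complex.I, htriple]
  simp only [hdot]
  push_cast
  rw [hns]
  field_simp
  linear_combination 4 * key
end

section
/- With the notation of the c-map setup, for all A, B ∈ {1,…,n} the following identity holds in ℂ: χ^A · ‖x⃗⁰ × x⃗^B‖² = χ^B · [ (x⃗⁰ × x⃗^A) · (x⃗⁰ × x⃗^B) − i · r⁰ · ( x⃗⁰ · (x⃗^A × x⃗^B) ) ], where the real quantities are regarded as complex numbers. -/
/-- The identity in null coordinates: `(a₀, p, m)`, `(u₀, u, s)`, `(v₀, v, t)` are triples
`(x₀, x₁ + i x₂, x₁ - i x₂)`. -/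
theorem null_coordinate_identity {r w a₀ p m : ℂ} (hw : w ≠ 0)
    (hm : m = (a₀ - r) / w) (hp : p = -(a₀ + r) * w) (u₀ u s v₀ v t : ℂ) :
    ((1 / 2) * u / w + u₀ - (1 / 2) * s * w) *
      ((a₀ ^ 2 + p * m) * (v₀ ^ 2 + v * t) - (a₀ * v₀ + (p * t + m * v) / 2) ^ 2) =
    ((1 / 2) * v / w + v₀ - (1 / 2) * t * w) *
      ((a₀ ^ 2 + p * m) * (u₀ * v₀ + (u * t + s * v) / 2)
        - (a₀ * u₀ + (p * s + m * u) / 2) * (a₀ * v₀ + (p * t + m * v) / 2)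
        - r * (a₀ * (s * v - u * t) + u₀ * (t * p - v * m) + v₀ * (m * u - p * s)) / 2) := by
  rw [hm, hp]
  field_simp
  ring

/-- The dot product in null coordinates. -/
theorem mul_add_mul_eq_null (a b c d : ℂ) :
    a * c + b * d = ((a + Complex.I * b) * (c - Complex.I * d)
      + (a - Complex.I * b) * (c + Complex.I * d)) / 2 := by
  linear_combination b * d * Complex.I_sq

/-- The identity behind the theorem, with `a₀, (a₁, a₂)` parametrised by the null direction `w`. -/
theorem stereographic_identity {r w a₀ a₁ a₂ : ℂ} (hw : w ≠ 0)
    (hm : a₁ - Complex.I * a₂ = (a₀ - r) / w) (hp : a₁ + Complex.I * a₂ = -(a₀ + r) * w)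
    (u₀ u₁ u₂ v₀ v₁ v₂ : ℂ) :
    ((1 / 2) * (u₁ + Complex.I * u₂) / w + u₀ - (1 / 2) * (u₁ - Complex.I * u₂) * w) *
      ((a₁ * v₂ - a₂ * v₁) ^ 2 + (a₂ * v₀ - a₀ * v₂) ^ 2 + (a₀ * v₁ - a₁ * v₀) ^ 2) =
    ((1 / 2) * (v₁ + Complex.I * v₂) / w + v₀ - (1 / 2) * (v₁ - Complex.I * v₂) * w) *
      ((a₁ * u₂ - a₂ * u₁) * (a₁ * v₂ - a₂ * v₁) + (a₂ * u₀ - a₀ * u₂) * (a₂ * v₀ - a₀ * v₂)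
        + (a₀ * u₁ - a₁ * u₀) * (a₀ * v₁ - a₁ * v₀)
        - Complex.I * r * (a₀ * (u₁ * v₂ - u₂ * v₁) + a₁ * (u₂ * v₀ - u₀ * v₂)
          + a₂ * (u₀ * v₁ - u₁ * v₀))) := by
  have key := null_coordinate_identity hw hm hp u₀ (u₁ + Complex.I * u₂) (u₁ - Complex.I * u₂)
    v₀ (v₁ + Complex.I * v₂) (v₁ - Complex.I * v₂)
  have haa : (a₁ + Complex.I * a₂) * (a₁ - Complex.I * a₂) = a₁ ^ 2 + a₂ ^ 2 := by
    linear_combination -a₂ ^ 2 * Complex.I_sq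
  have hvv : (v₁ + Complex.I * v₂) * (v₁ - Complex.I * v₂) = v₁ ^ 2 + v₂ ^ 2 := by
    linear_combination -v₂ ^ 2 * Complex.I_sq
  rw [haa, hvv, ← mul_add_mul_eq_null, ← mul_add_mul_eq_null, ← mul_add_mul_eq_null] at key
  linear_combination key

/-- the identity
`χ^A ‖x⃗⁰×x⃗^B‖² = χ^B [(x⃗⁰×x⃗^A)·(x⃗⁰×x⃗^B) − i r⁰ (x⃗⁰·(x⃗^A×x⃗^B))]`
in the c-map setup (components `1,2,3` of the paper are `0,1,2` in `Fin 3`). -/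
theorem stmt14 (n : ℕ) (hn : 1 ≤ n) (xv : Fin (n + 1) → Fin 3 → ℝ)
    (x : Fin (n + 1) → ℝ) (hx : ∀ I, x I = xv I 0)
    (z : Fin (n + 1) → ℂ)
    (hz : ∀ I, z I = (1 / 2 : ℂ) * ((xv I 1 : ℂ) + Complex.I * (xv I 2 : ℂ)))
    (hz0 : z 0 ≠ 0)
    (r : ℝ) (hr : r = Real.sqrt (dot3 (xv 0) (xv 0)))
    (ζp : ℂ)
    (hζp : ζp = ((x 0 : ℂ) - (r : ℂ)) / (2 * starRingEnd ℂ (z 0)))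
    (χ : Fin (n + 1) → ℂ)
    (hχ : ∀ A, χ A = (z A / ζp + (x A : ℂ) - starRingEnd ℂ (z A) * ζp) / (r : ℂ)) :
    ∀ A B : Fin (n + 1), A ≠ 0 → B ≠ 0 →
      χ A * ((dot3 (cross3 (xv 0) (xv B)) (cross3 (xv 0) (xv B)) : ℝ) : ℂ) =
        χ B * (((dot3 (cross3 (xv 0) (xv A)) (cross3 (xv 0) (xv B)) : ℝ) : ℂ)
          - Complex.I * (r : ℂ) * ((dot3 (xv 0) (cross3 (xv A) (xv B)) : ℝ) : ℂ)) := by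
  intro A B _ _
  have hpos : (0 : ℝ) ≤ dot3 (xv 0) (xv 0) := by
    exact Finset.sum_nonneg fun i _ => mul_self_nonneg _
  have hr2 : r ^ 2 = xv 0 0 ^ 2 + xv 0 1 ^ 2 + xv 0 2 ^ 2 := by
    rw [hr, Real.sq_sqrt hpos, dot3, Fin.sum_univ_three]
    ring
  have hrC : (r : ℂ) ^ 2 = (xv 0 0 : ℂ) ^ 2 + (xv 0 1 : ℂ) ^ 2 + (xv 0 2 : ℂ) ^ 2 := by
    exact_mod_cast hr2
  have hconj : ∀ I, starRingEnd ℂ (z I) =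
      (1 / 2 : ℂ) * ((xv I 1 : ℂ) - Complex.I * (xv I 2 : ℂ)) := by
    intro I
    simp [hz, sub_eq_add_neg, Complex.conj_ofNat]
  have hm : (xv 0 1 : ℂ) - Complex.I * (xv 0 2 : ℂ) ≠ 0 := by
    intro h
    exact hz0 ((map_eq_zero (starRingEnd ℂ)).1 (by rw [hconj, h, mul_zero]))
  have hp : (xv 0 1 : ℂ) + Complex.I * (xv 0 2 : ℂ) ≠ 0 := by
    intro h
    exact hz0 (by rw [hz, h, mul_zero])
  have hprod : ((xv 0 1 : ℂ) - Complex.I * (xv 0 2 : ℂ)) *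
      ((xv 0 1 : ℂ) + Complex.I * (xv 0 2 : ℂ)) = -((xv 0 0 : ℂ) - r) * ((xv 0 0 : ℂ) + r) := by
    linear_combination -hrC - (xv 0 2 : ℂ) ^ 2 * Complex.I_sq
  have hζ : ζp * ((xv 0 1 : ℂ) - Complex.I * (xv 0 2 : ℂ)) = (xv 0 0 : ℂ) - r := by
    rw [hζp, hconj, hx]
    field_simp
  have har : (xv 0 0 : ℂ) - r ≠ 0 := by
    intro h
    rw [h] at hprod
    exact mul_ne_zero hm hp (by rw [hprod]; ring)
  have hζ0 : ζp ≠ 0 := by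
    rintro rfl
    exact har (by rw [← hζ, zero_mul])
  have key := stereographic_identity (r := r) hζ0
    (by rw [eq_div_iff hζ0, mul_comm]; exact hζ)
    (mul_left_cancel₀ hm (by linear_combination hprod + ((xv 0 0 : ℂ) + r) * hζ))
    (xv A 0) (xv A 1) (xv A 2) (xv B 0) (xv B 1) (xv B 2)
  rw [hχ, hχ, hconj, hconj, hz, hz, hx, hx]
  simp only [dot3, cross3, Fin.sum_univ_three, Matrix.cons_val_zero, Matrix.cons_val_one,
    Matrix.cons_val]
  push_cast
  linear_combination key / r
end

section
/- Let F : (Fin n → ℂ) → ℂ be complex-differentiable everywhere and homogeneous of degree two: F(t • w) = t² · F(w) for all t ∈ ℂ and w. On the open set D = { x ∈ Fin (n+1) → (Fin 3 → ℝ) : z⁰(x) ≠ 0 } define χ(x) = (χ^1(x),…,χ^n(x)) as in the c-map setup and set L(x) := 2 r⁰ · Im( F(χ(x)) ). Then at every point of D: (i) for each A ∈ {1,…,n}, the partial derivative of L along the basis direction of x^A_1 equals 2 · Im( F_A(χ(x)) ); and (ii) ∑_{I=0}^{n} (x⃗⁰ · x⃗^I) · (partial derivative of L along the basis direction of x^I_1)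 = x⁰ · L(x). -/
/-- The configuration space of `n+1` points in `ℝ³`. -/
abbrev Conf (n : ℕ) := Fin (n + 1) → Fin 3 → ℝ

/-- Standard basis vector `e_{I,i}` of the configuration space. -/
noncomputable def e {n : ℕ} (I : Fin (n + 1)) (i : Fin 3) : Conf n :=
  Pi.single I (Pi.single i 1)

/-- The complex coordinate `z = ½(x₂ + i x₃)` of the `I`-th point. -/
noncomputable def zCoord {n : ℕ} (I : Fin (n + 1)) (x : Conf n) : ℂ :=
  (1 / 2 : ℂ) * ((x I 1 : ℂ) + Complex.I * (x I 2 : ℂ))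

/-- The Euclidean norm of the `0`-th point. -/
noncomputable def radius {n : ℕ} (x : Conf n) : ℝ := Real.sqrt (dot3 (x 0) (x 0))

/-- The root `ζ₊ = (x⁰ - r⁰) / (2 z̄⁰)`. -/
noncomputable def zetaPlus {n : ℕ} (x : Conf n) : ℂ :=
  ((x 0 0 : ℂ) - (radius x : ℂ)) / (2 * starRingEnd ℂ (zCoord 0 x))

/-- The c-map coordinates `χ^A`. -/
noncomputable def chi {n : ℕ} (x : Conf n) (A : Fin n) : ℂ :=
  (zCoord A.succ x / zetaPlus x + (x A.succ 0 : ℂ) -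
    starRingEnd ℂ (zCoord A.succ x) * zetaPlus x) / (radius x : ℂ)

lemma zCoord_ne_zero_iff {n : ℕ} (I : Fin (n + 1)) (x : Conf n) :
    zCoord I x ≠ 0 ↔ 0 < x I 1 ^ 2 + x I 2 ^ 2 := by
  have h : Complex.normSq (zCoord I x) = (x I 1 ^ 2 + x I 2 ^ 2) / 4 := by
    simp [zCoord, Complex.normSq_apply]
    ring
  rw [← Complex.normSq_pos, h]
  constructor <;> intro h <;> linarith

lemma dot3_self_pos {n : ℕ} {x : Conf n} (hx : zCoord 0 x ≠ 0) : 0 < dot3 (x 0) (x 0) := by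
  rw [zCoord_ne_zero_iff] at hx
  simp only [dot3, Fin.sum_univ_three]
  nlinarith [sq_nonneg (x 0 0)]

lemma radius_pos {n : ℕ} {x : Conf n} (hx : zCoord 0 x ≠ 0) : 0 < radius x :=
  Real.sqrt_pos.2 (dot3_self_pos hx)

lemma radius_sq {n : ℕ} (x : Conf n) : radius x ^ 2 = x 0 0 ^ 2 + x 0 1 ^ 2 + x 0 2 ^ 2 := by
  rw [radius, Real.sq_sqrt] <;> simp only [dot3, Fin.sum_univ_three]
  · ring
  · nlinarith [sq_nonneg (x 0 0), sq_nonneg (x 0 1), sq_nonneg (x 0 2)]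

lemma coord_lt_radius {n : ℕ} {x : Conf n} (hx : zCoord 0 x ≠ 0) : x 0 0 < radius x := by
  have h1 := radius_pos hx
  have h2 := radius_sq x
  rw [zCoord_ne_zero_iff] at hx
  nlinarith

lemma zetaPlus_ne_zero {n : ℕ} {x : Conf n} (hx : zCoord 0 x ≠ 0) : zetaPlus x ≠ 0 := by
  refine div_ne_zero ?_ (mul_ne_zero two_ne_zero ((map_ne_zero _).2 hx))
  exact_mod_cast (sub_neg.2 (coord_lt_radius hx)).ne

lemma differentiable_zCoord {n : ℕ} (I : Fin (n + 1)) :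
    Differentiable ℝ (zCoord I : Conf n → ℂ) := by
  have h (i : Fin 3) : Differentiable ℝ (fun x : Conf n => (x I i : ℂ)) :=
    Complex.ofRealCLM.differentiable.comp (by fun_prop : Differentiable ℝ fun x : Conf n => x I i)
  exact ((h 1).add ((h 2).const_mul Complex.I)).const_mul _

lemma differentiableAt_radius {n : ℕ} {x : Conf n} (hx : zCoord 0 x ≠ 0) :
    DifferentiableAt ℝ (radius : Conf n → ℝ) x := by
  refine DifferentiableAt.sqrt ?_ (dot3_self_pos hx).ne'
  unfold dot3
  fun_prop

lemma differentiableAt_chi {n : ℕ} {x : Conf n} (hx : zCoord 0 x ≠ 0) :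
    DifferentiableAt ℝ (chi : Conf n → Fin n → ℂ) x := by
  have hr : DifferentiableAt ℝ (fun x : Conf n => (radius x : ℂ)) x :=
    Complex.ofRealCLM.differentiableAt.comp x (differentiableAt_radius hx)
  have hc (I : Fin (n + 1)) : DifferentiableAt ℝ (fun x : Conf n => (x I 0 : ℂ)) x :=
    Complex.ofRealCLM.differentiableAt.comp x
      (by fun_prop : DifferentiableAt ℝ (fun x : Conf n => x I 0) x)
  have hz (I : Fin (n + 1)) := (differentiable_zCoord (n := n) I) x
  have hs (I : Fin (n + 1)) :
      DifferentiableAt ℝ (fun x : Conf n => starRingEnd ℂ (zCoord I x)) x :=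
    Complex.conjCLE.differentiableAt.comp x (hz I)
  have hζ : DifferentiableAt ℝ (zetaPlus : Conf n → ℂ) x :=
    ((hc 0).sub hr).mul (((hs 0).const_mul 2).inv
      (mul_ne_zero two_ne_zero ((map_ne_zero (starRingEnd ℂ)).2 hx)))
  refine differentiableAt_pi.2 fun A => ?_
  exact ((((hz A.succ).mul (hζ.inv (zetaPlus_ne_zero hx))).add (hc A.succ)).sub
    ((hs A.succ).mul hζ)).mul (hr.inv (by exact_mod_cast (radius_pos hx).ne'))

lemma zCoord_add_smul_e {n : ℕ} (I J : Fin (n + 1)) (x : Conf n) (t : ℝ) :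
    zCoord I (x + t • e J 0) = zCoord I x := by
  by_cases h : I = J
  · subst h; simp [zCoord, e]
  · simp [zCoord, e, h]

lemma add_smul_e_self {n : ℕ} (I : Fin (n + 1)) (x : Conf n) (t : ℝ) :
    (x + t • e I 0) I 0 = x I 0 + t := by
  simp [e]

lemma add_smul_e_of_ne {n : ℕ} {I J : Fin (n + 1)} (h : I ≠ J) (x : Conf n) (t : ℝ) :
    (x + t • e J 0) I = x I := by
  simp [e, h]

lemma hasLineDerivAt_chi_succ {n : ℕ} (A : Fin n) (x : Conf n) :
    HasLineDerivAt ℝ (chi : Conf n → Fin n → ℂ) ((radius x : ℂ)⁻¹ • Pi.single A 1) x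
      (e A.succ 0) := by
  refine hasDerivAt_pi.2 fun B => ?_
  have hr (t : ℝ) : radius (x + t • e A.succ 0) = radius x := by
    rw [radius, add_smul_e_of_ne (Fin.succ_ne_zero A).symm, radius]
  have hζ (t : ℝ) : zetaPlus (x + t • e A.succ 0) = zetaPlus x := by
    rw [zetaPlus, add_smul_e_of_ne (Fin.succ_ne_zero A).symm, hr, zCoord_add_smul_e, zetaPlus]
  simp only [chi, hr, hζ, zCoord_add_smul_e]
  by_cases h : B = A
  · subst h
    simp only [add_smul_e_self, Complex.ofReal_add]
    have := (((((hasDerivAt_id (0 : ℝ)).ofReal_comp.const_add (x B.succ 0 : ℂ)).const_add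
      (zCoord B.succ x / zetaPlus x)).sub_const
        (starRingEnd ℂ (zCoord B.succ x) * zetaPlus x)).div_const (radius x : ℂ))
    simpa using this
  · have h' : B.succ ≠ A.succ := fun h' => h (Fin.succ_injective _ h')
    simp only [add_smul_e_of_ne h']
    simpa [h] using hasDerivAt_const (0 : ℝ) _

lemma hasLineDerivAt_radius_zero {n : ℕ} {x : Conf n} (hx : zCoord 0 x ≠ 0) :
    HasLineDerivAt ℝ (radius : Conf n → ℝ) (x 0 0 / radius x) x (e 0 0) := by
  have h : HasDerivAt (fun t : ℝ => (x 0 0 + t) ^ 2 + x 0 1 ^ 2 + x 0 2 ^ 2) (2 * x 0 0) 0 := by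
    simpa using ((((hasDerivAt_id (0 : ℝ)).const_add (x 0 0)).pow 2).add_const
      (x 0 1 ^ 2)).add_const (x 0 2 ^ 2)
  have hd : (fun t : ℝ => radius (x + t • e 0 0)) =
      fun t => Real.sqrt ((x 0 0 + t) ^ 2 + x 0 1 ^ 2 + x 0 2 ^ 2) := by
    funext t
    rw [radius, dot3, Fin.sum_univ_three]
    simp [e]
    ring_nf
  have hs : radius x = Real.sqrt (x 0 0 ^ 2 + x 0 1 ^ 2 + x 0 2 ^ 2) := by
    rw [← radius_sq, Real.sqrt_sq (radius_pos hx).le]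
  have h0 : x 0 0 ^ 2 + x 0 1 ^ 2 + x 0 2 ^ 2 ≠ 0 := by
    rw [← radius_sq]; exact (pow_pos (radius_pos hx) 2).ne'
  rw [HasLineDerivAt, hd]
  refine (h.sqrt (by simpa using h0)).congr_deriv ?_
  rw [hs, add_zero, mul_div_mul_left _ _ two_ne_zero]

lemma dot3_eq_zCoord {n : ℕ} (I J : Fin (n + 1)) (x : Conf n) :
    (dot3 (x I) (x J) : ℂ) = x I 0 * x J 0 +
      2 * (zCoord I x * starRingEnd ℂ (zCoord J x) + starRingEnd ℂ (zCoord I x) * zCoord J x) := by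
  simp only [dot3, Fin.sum_univ_three, zCoord, map_mul, map_add, Complex.conj_I,
    Complex.conj_ofReal, Complex.ofReal_add, Complex.ofReal_mul, map_div₀, map_one, map_ofNat]
  linear_combination (x I 2 : ℂ) * x J 2 * Complex.I_sq

lemma hasLineDerivAt_chi_zero {n : ℕ} {x : Conf n} (hx : zCoord 0 x ≠ 0) :
    HasLineDerivAt ℝ (chi : Conf n → Fin n → ℂ)
      (fun A => -(dot3 (x 0) (x A.succ) : ℂ) / (radius x : ℂ) ^ 3) x (e 0 0) := by
  refine hasDerivAt_pi.2 fun A => ?_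
  have hr : HasDerivAt (fun t : ℝ => (radius (x + t • e 0 0) : ℂ))
      ((x 0 0 / radius x : ℝ) : ℂ) 0 := (hasLineDerivAt_radius_zero hx).ofReal_comp
  have hr0 : (radius x : ℂ) ≠ 0 := by exact_mod_cast (radius_pos hx).ne'
  have hζ0 := zetaPlus_ne_zero hx
  have hs0 : starRingEnd ℂ (zCoord 0 x) ≠ 0 := (map_ne_zero _).2 hx
  have hζz : zetaPlus x * (2 * starRingEnd ℂ (zCoord 0 x)) = x 0 0 - radius x :=
    div_mul_cancel₀ _ (mul_ne_zero two_ne_zero hs0)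
  have hζ : HasDerivAt (fun t : ℝ => zetaPlus (x + t • e 0 0)) (-zetaPlus x / radius x) 0 := by
    simp only [zetaPlus, zCoord_add_smul_e, add_smul_e_self, Complex.ofReal_add]
    refine ((((hasDerivAt_id (0 : ℝ)).ofReal_comp.const_add (x 0 0 : ℂ)).sub hr).div_const
      (2 * starRingEnd ℂ (zCoord 0 x))).congr_deriv ?_
    push_cast
    field_simp
    ring
  have hprod : 4 * (zCoord 0 x * starRingEnd ℂ (zCoord 0 x)) =
      (radius x : ℂ) ^ 2 - (x 0 0 : ℂ) ^ 2 := by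
    have h1 := dot3_eq_zCoord 0 0 x
    have h2 : dot3 (x 0) (x 0) = radius x ^ 2 := (Real.sq_sqrt (dot3_self_pos hx).le).symm
    rw [h2] at h1
    push_cast at h1
    linear_combination -h1
  have hz2 : 2 * zCoord 0 x = -zetaPlus x * (x 0 0 + radius x) := by
    refine mul_right_cancel₀ (mul_ne_zero two_ne_zero hs0) ?_
    linear_combination hprod + (x 0 0 + radius x : ℂ) * hζz
  simp only [chi, zCoord_add_smul_e, add_smul_e_of_ne (Fin.succ_ne_zero A)]
  refine (((((hasDerivAt_const (0 : ℝ) (zCoord A.succ x)).div hζ (by simpa using hζ0)).add_const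
    (x A.succ 0 : ℂ)).sub (hζ.const_mul (starRingEnd ℂ (zCoord A.succ x)))).div hr
      (by simpa using hr0)).congr_deriv ?_
  rw [dot3_eq_zCoord]
  simp only [Pi.sub_apply, Pi.div_apply, zero_smul, add_zero]
  push_cast
  field_simp
  linear_combination zetaPlus x * starRingEnd ℂ (zCoord A.succ x) * hz2 +
    zCoord A.succ x * hζz

lemma fderiv_potential {n : ℕ} {F : (Fin n → ℂ) → ℂ} (hF : Differentiable ℂ F) {x v : Conf n}
    (hx : zCoord 0 x ≠ 0) {r' : ℝ} {χ' : Fin n → ℂ}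
    (hr : HasLineDerivAt ℝ radius r' x v) (hχ : HasLineDerivAt ℝ chi χ' x v) :
    fderiv ℝ (fun y => 2 * radius y * (F (chi y)).im) x v =
      2 * r' * (F (chi x)).im + 2 * radius x * (fderiv ℂ F (chi x) χ').im := by
  have hFr (w : Fin n → ℂ) : HasFDerivAt F ((fderiv ℂ F w).restrictScalars ℝ) w :=
    (hF w).hasFDerivAt.restrictScalars ℝ
  have hd : DifferentiableAt ℝ (fun y => 2 * radius y * (F (chi y)).im) x :=
    ((differentiableAt_radius hx).const_mul 2).mul (Complex.imCLM.differentiableAt.comp x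
      ((hFr _).differentiableAt.comp x (differentiableAt_chi hx)))
  have h0 : chi (x + (0 : ℝ) • v) = chi x := by simp
  have hFχ : HasDerivAt (fun t : ℝ => (F (chi (x + t • v))).im) (fderiv ℂ F (chi x) χ').im 0 :=
    Complex.imCLM.hasFDerivAt.comp_hasDerivAt (0 : ℝ)
      (HasFDerivAt.comp_hasDerivAt (f := fun t : ℝ => chi (x + t • v))
        (l' := (fderiv ℂ F (chi x)).restrictScalars ℝ) (0 : ℝ)
        (by simpa only [h0] using hFr (chi x)) hχ)
  rw [← hd.lineDeriv_eq_fderiv]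
  refine HasLineDerivAt.lineDeriv ?_
  exact ((HasDerivAt.const_mul 2 hr).mul hFχ).congr_deriv (by simp)

/-- for the c-map `L`-potential `L = 2r⁰ Im F(χ)`,
(i) `∂L/∂x^A = 2 Im F_A(χ)` and (ii) `∑_I (x⃗⁰·x⃗^I) ∂L/∂x^I = x⁰ L`
(components `1,2,3` of the paper are `0,1,2` in `Fin 3`). -/
theorem stmt16 (n : ℕ) (hn : 1 ≤ n) (F : (Fin n → ℂ) → ℂ)
    (hF : Differentiable ℂ F)
    (hhom : ∀ (t : ℂ) (w : Fin n → ℂ), F (t • w) = t ^ 2 * F w)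
    (z : Fin (n + 1) → Conf n → ℂ)
    (hz : ∀ I, z I = fun x => (1 / 2 : ℂ) * ((x I 1 : ℂ) + Complex.I * (x I 2 : ℂ)))
    (D : Set (Conf n)) (hD : D = {x : Conf n | z 0 x ≠ 0})
    (r : Conf n → ℝ) (hr : r = fun x => Real.sqrt (dot3 (x 0) (x 0)))
    (ζ : Conf n → ℂ)
    (hζ : ζ = fun x => ((x 0 0 : ℂ) - (r x : ℂ)) / (2 * starRingEnd ℂ (z 0 x)))
    (χ : Conf n → Fin n → ℂ)
    (hχ : χ = fun x A =>
      (z A.succ x / ζ x + (x A.succ 0 : ℂ) - starRingEnd ℂ (z A.succ x) * ζ x) / (r x : ℂ))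
    (L : Conf n → ℝ) (hL : L = fun x => 2 * r x * (F (χ x)).im) :
    (∀ A : Fin n, ∀ x ∈ D,
      fderiv ℝ L x (e A.succ 0) = 2 * (fderiv ℂ F (χ x) (Pi.single A 1)).im) ∧
    (∀ x ∈ D,
      ∑ I : Fin (n + 1), dot3 (x 0) (x I) * fderiv ℝ L x (e I 0) = x 0 0 * L x) := by
  obtain rfl : z = zCoord := funext hz
  obtain rfl : r = radius := hr
  obtain rfl : ζ = zetaPlus := hζ
  obtain rfl : χ = chi := hχ
  subst hD hL
  have hsucc (A : Fin n) (x : Conf n) (hx : zCoord 0 x ≠ 0) :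
      fderiv ℝ (fun y => 2 * radius y * (F (chi y)).im) x (e A.succ 0) =
        2 * (fderiv ℂ F (chi x) (Pi.single A 1)).im := by
    have hr : HasLineDerivAt ℝ radius 0 x (e A.succ 0) := by
      simpa [HasLineDerivAt, radius, add_smul_e_of_ne (Fin.succ_ne_zero A).symm] using
        hasDerivAt_const (0 : ℝ) (radius x)
    rw [fderiv_potential hF hx hr (hasLineDerivAt_chi_succ A x), map_smul, smul_eq_mul,
      ← Complex.ofReal_inv, Complex.im_ofReal_mul]
    have := (radius_pos hx).ne'
    field_simp
    ring
  refine ⟨fun A x hx => hsucc A x hx, fun x hx => ?_⟩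
  have hx : zCoord 0 x ≠ 0 := hx
  have hr0 := (radius_pos hx).ne'
  rw [Fin.sum_univ_succ, fderiv_potential hF hx (hasLineDerivAt_radius_zero hx)
    (hasLineDerivAt_chi_zero hx)]
  simp only [hsucc _ x hx]
  have hlin : (fderiv ℂ F (chi x)
      (fun A => -(dot3 (x 0) (x A.succ) : ℂ) / (radius x : ℂ) ^ 3)).im =
      -(∑ A : Fin n, dot3 (x 0) (x A.succ) *
        (fderiv ℂ F (chi x) (Pi.single A 1)).im) / radius x ^ 3 := by
    rw [← ContinuousLinearMap.coe_coe, LinearMap.pi_apply_eq_sum_univ, Complex.im_sum, neg_div, Finset.sum_div,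
      ← Finset.sum_neg_distrib]
    refine Finset.sum_congr rfl fun A _ => ?_
    have hc : -(dot3 (x 0) (x A.succ) : ℂ) / (radius x : ℂ) ^ 3 =
        ((-dot3 (x 0) (x A.succ) / radius x ^ 3 : ℝ) : ℂ) := by push_cast; rfl
    have hs : (fun j => if A = j then (1 : ℂ) else 0) = Pi.single A 1 := by
      funext j
      simp [Pi.single_apply, eq_comm]
    rw [hc, hs, smul_eq_mul, Complex.im_ofReal_mul]
    ring
  have hsum : ∑ A : Fin n, dot3 (x 0) (x A.succ) *
      (2 * (fderiv ℂ F (chi x) (Pi.single A 1)).im) =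
      2 * ∑ A : Fin n, dot3 (x 0) (x A.succ) * (fderiv ℂ F (chi x) (Pi.single A 1)).im := by
    rw [Finset.mul_sum]
    exact Finset.sum_congr rfl fun A _ => by ring
  have hdot : dot3 (x 0) (x 0) = radius x ^ 2 := (Real.sq_sqrt (dot3_self_pos hx).le).symm
  rw [hlin, hsum, hdot]
  field_simp
  ring
end

section
/- Let F : (Fin n → ℂ) → ℂ be complex-differentiable everywhere and homogeneous of degree two: F(t • w) = t² · F(w) for all t ∈ ℂ and w. With the notation of the c-map setup, the following identity holds (equality of the two expressions for the hyperkähler potential): (4|z⁰|² / r⁰) · Im( ∑_A conj(χ^A) · F_A(χ) ) = (1/(r⁰)³) · ∑_{A,B} ( (x⃗⁰ × x⃗^A) · (x⃗⁰ × x⃗^B) ) · Im( F_{AB}(χ) ), where χ = (χ^1,…,χ^n). -/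
open Filter Topology

/-- If `h` is entire and `(h s - h 0) / s → c` at infinity, then `h` has derivative `c` at `0`. -/
theorem deriv_zero_eq_of_tendsto_cocompact {h : ℂ → ℂ} {c : ℂ} (hh : Differentiable ℂ h)
    (hc : Tendsto (fun s => s⁻¹ * (h s - h 0)) (cocompact ℂ) (𝓝 c)) : deriv h 0 = c := by
  have hd : Differentiable ℂ (dslope h 0) := by
    rw [← differentiableOn_univ, Complex.differentiableOn_dslope univ_mem]
    exact hh.differentiableOn
  have ht : Tendsto (dslope h 0) (cocompact ℂ) (𝓝 c) := by
    refine hc.congr' ?_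
    have hne : ∀ᶠ s : ℂ in cocompact ℂ, s ≠ 0 := isCompact_singleton.compl_mem_cocompact
    filter_upwards [hne] with s hs
    simp [dslope_of_ne _ hs, slope_def_field, div_eq_inv_mul]
  rw [← dslope_same, hd.apply_eq_of_tendsto_cocompact 0 ht]

/-- The derivative of an entire function homogeneous of degree two is a symmetric form. -/
theorem fderiv_apply_comm_of_homogeneous_two {E : Type*} [NormedAddCommGroup E]
    [NormedSpace ℂ E] {F : E → ℂ} (hF : Differentiable ℂ F)
    (hhom : ∀ (t : ℂ) (w : E), F (t • w) = t ^ 2 * F w) (w v : E) :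
    fderiv ℂ F w v = fderiv ℂ F v w := by
  have hline : ∀ a b : E, HasDerivAt (fun s : ℂ => F (a + s • b)) (fderiv ℂ F a b) 0 := by
    intro a b
    have hl : HasDerivAt (fun s : ℂ => a + s • b) b 0 := by
      simpa using ((hasDerivAt_id (0 : ℂ)).smul_const b).const_add a
    have hFa : HasFDerivAt F (fderiv ℂ F a) (a + (0 : ℂ) • b) := by
      simpa using (hF a).hasFDerivAt
    exact hFa.comp_hasDerivAt 0 hl
  have hder : HasDerivAt (fun s : ℂ => F (w + s • v) - s ^ 2 * F v) (fderiv ℂ F w v) 0 := by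
    have hsq : HasDerivAt (fun s : ℂ => s ^ 2 * F v) 0 0 := by
      simpa using (hasDerivAt_pow 2 (0 : ℂ)).mul_const (F v)
    simpa using (hline w v).fun_sub hsq
  rw [← hder.deriv]
  refine deriv_zero_eq_of_tendsto_cocompact (by fun_prop) ?_
  have hslope := (hline v w).tendsto_slope_zero
  have hne : ∀ᶠ s : ℂ in cocompact ℂ, s ≠ 0 := isCompact_singleton.compl_mem_cocompact
  have hinv₀ : Tendsto (fun s : ℂ => s⁻¹) (cocompact ℂ) (𝓝 0) := by
    rw [← Metric.cobounded_eq_cocompact]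
    exact tendsto_inv₀_cobounded
  have hinv : Tendsto (fun s : ℂ => s⁻¹) (cocompact ℂ) (𝓝[≠] 0) :=
    tendsto_nhdsWithin_iff.2 ⟨hinv₀, hne.mono fun s hs => inv_ne_zero hs⟩
  have hlim := (hslope.comp hinv).sub (hinv₀.mul_const (F w))
  rw [zero_mul, sub_zero] at hlim
  refine hlim.congr' ?_
  filter_upwards [hne] with s hs
  have hscale : F (w + s • v) = s ^ 2 * F (v + s⁻¹ • w) := by
    rw [← hhom, smul_add, smul_inv_smul₀ hs, add_comm]
  simp only [Function.comp_apply, zero_add, zero_smul, add_zero, inv_inv, smul_eq_mul, hscale]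
  field_simp
  ring

/-- A form with symmetric coefficients pairs `χ` with its conjugate through the real parts. -/
theorem im_sum_conj_mul_sum_of_symm {ι : Type*} [Fintype ι] (χ : ι → ℂ) (H : ι → ι → ℂ)
    (hH : ∀ A B, H A B = H B A) :
    (∑ A, starRingEnd ℂ (χ A) * ∑ B, χ B * H A B).im =
      ∑ A, ∑ B, (starRingEnd ℂ (χ A) * χ B).re * (H A B).im := by
  have hanti : ∑ A, ∑ B, (starRingEnd ℂ (χ A) * χ B).im * (H A B).re = 0 := by
    have hswap : ∑ A, ∑ B, (starRingEnd ℂ (χ A) * χ B).im * (H A B).re =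
        -∑ A, ∑ B, (starRingEnd ℂ (χ A) * χ B).im * (H A B).re := by
      conv_lhs => rw [Finset.sum_comm]
      simp_rw [← Finset.sum_neg_distrib]
      refine Finset.sum_congr rfl fun A _ => Finset.sum_congr rfl fun B _ => ?_
      rw [hH B A]
      simp only [Complex.mul_im, Complex.conj_re, Complex.conj_im]
      ring
    linarith
  simp_rw [Finset.mul_sum, Complex.im_sum, ← mul_assoc, Complex.mul_im _ (H _ _),
    Finset.sum_add_distrib, hanti, add_zero]

/-- Explicit real form of the twistor coordinate `χ`, for `x⃗⁰ = (c, a, b)` and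
`x⃗ = (x, p, q)`. -/
theorem twistor_coordinate_eq {a b c r : ℝ} (hN : a ^ 2 + b ^ 2 ≠ 0)
    (hr : r ^ 2 = c ^ 2 + a ^ 2 + b ^ 2) (x p q : ℝ) (z₀ z ζ : ℂ)
    (hz₀ : z₀ = (1 / 2 : ℂ) * (a + Complex.I * b)) (hz : z = (1 / 2 : ℂ) * (p + Complex.I * q))
    (hζ : ζ = ((c : ℂ) - r) / (2 * starRingEnd ℂ z₀)) :
    z / ζ + x - starRingEnd ℂ z * ζ =
      (((a ^ 2 + b ^ 2) * x - c * (a * p + b * q) : ℝ) - (r * (a * q - b * p) : ℝ) * Complex.I) /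
        ((a ^ 2 + b ^ 2 : ℝ) : ℂ) := by
  have hNC : (a : ℂ) ^ 2 + (b : ℂ) ^ 2 ≠ 0 := by exact_mod_cast hN
  have hrC : (r : ℂ) ^ 2 = (c : ℂ) ^ 2 + (a : ℂ) ^ 2 + (b : ℂ) ^ 2 := by exact_mod_cast hr
  have hI := Complex.I_sq
  have hw : ((a : ℂ) - Complex.I * b) * (a + Complex.I * b) = a ^ 2 + b ^ 2 := by
    linear_combination (-(b : ℂ) ^ 2) * hI
  have hw₁ : (a : ℂ) - Complex.I * b ≠ 0 := left_ne_zero_of_mul (hw ▸ hNC)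
  have hcr : ((c : ℂ) - r) * (c + r) = -((a : ℂ) ^ 2 + b ^ 2) := by
    linear_combination -hrC
  have hcr₁ : (c : ℂ) - r ≠ 0 := left_ne_zero_of_mul (hcr ▸ neg_ne_zero.2 hNC)
  have hζ₁ : ζ = (c - r) / (a - Complex.I * b) := by
    rw [hζ, hz₀]
    congr 1
    simp only [map_mul, map_add, map_div₀, map_one, map_ofNat, Complex.conj_ofReal, Complex.conj_I]
    ring
  have hζ₂ : ζ = (c - r) * (a + Complex.I * b) / (a ^ 2 + b ^ 2) := by
    rw [hζ₁, div_eq_div_iff hw₁ hNC]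
    linear_combination (-((c : ℂ) - r)) * hw
  have hζ₃ : ζ⁻¹ = -((a - Complex.I * b) * (c + r)) / (a ^ 2 + b ^ 2) := by
    rw [hζ₁, inv_div, div_eq_div_iff hcr₁ hNC]
    linear_combination ((a : ℂ) - Complex.I * b) * hcr
  rw [div_eq_mul_inv z, hζ₃, hζ₂, hz]
  simp only [map_mul, map_add, map_div₀, map_one, map_ofNat, Complex.conj_ofReal, Complex.conj_I]
  push_cast
  field_simp
  ring_nf
  simp only [hI]
  ring

/-- Real part of the product of two twistor coordinates as a product of cross products. -/
theorem normSq_mul_re_conj_mul_eq_dot_cross {v₀ v w : Fin 3 → ℝ} {z₀ zv zw ζ χv χw : ℂ} {r : ℝ}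
    (hz₀ : z₀ = (1 / 2 : ℂ) * ((v₀ 1 : ℂ) + Complex.I * (v₀ 2 : ℂ))) (hz₀ne : z₀ ≠ 0)
    (hzv : zv = (1 / 2 : ℂ) * ((v 1 : ℂ) + Complex.I * (v 2 : ℂ)))
    (hzw : zw = (1 / 2 : ℂ) * ((w 1 : ℂ) + Complex.I * (w 2 : ℂ)))
    (hr : r = Real.sqrt (dot3 v₀ v₀))
    (hζ : ζ = ((v₀ 0 : ℂ) - (r : ℂ)) / (2 * starRingEnd ℂ z₀))
    (hχv : χv = (zv / ζ + (v 0 : ℂ) - starRingEnd ℂ zv * ζ) / (r : ℂ))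
    (hχw : χw = (zw / ζ + (w 0 : ℂ) - starRingEnd ℂ zw * ζ) / (r : ℂ)) :
    4 * Complex.normSq z₀ / r * (starRingEnd ℂ χv * χw).re =
      1 / r ^ 3 * dot3 (cross3 v₀ v) (cross3 v₀ w) := by
  have hnorm : 4 * Complex.normSq z₀ = v₀ 1 ^ 2 + v₀ 2 ^ 2 := by
    rw [hz₀]
    simp [Complex.normSq_apply]
    ring
  have hpos : 0 < v₀ 1 ^ 2 + v₀ 2 ^ 2 := by
    rw [← hnorm]
    exact mul_pos four_pos (Complex.normSq_pos.2 hz₀ne)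
  have hdot : dot3 v₀ v₀ = v₀ 0 ^ 2 + v₀ 1 ^ 2 + v₀ 2 ^ 2 := by
    simp only [dot3, Fin.sum_univ_three]
    ring
  have hdotpos : 0 < dot3 v₀ v₀ := by
    rw [hdot]
    nlinarith [sq_nonneg (v₀ 0)]
  have hrpos : 0 < r := hr ▸ Real.sqrt_pos.2 hdotpos
  have hr2 : r ^ 2 = v₀ 0 ^ 2 + v₀ 1 ^ 2 + v₀ 2 ^ 2 := by
    rw [hr, Real.sq_sqrt hdotpos.le, hdot]
  rw [twistor_coordinate_eq hpos.ne' hr2 _ _ _ z₀ zv ζ hz₀ hzv hζ, div_div,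
    ← Complex.ofReal_mul] at hχv
  rw [twistor_coordinate_eq hpos.ne' hr2 _ _ _ z₀ zw ζ hz₀ hzw hζ, div_div,
    ← Complex.ofReal_mul] at hχw
  rw [hnorm, hχv, hχw]
  simp only [dot3, cross3, Fin.sum_univ_three, Complex.mul_re, Complex.conj_re, Complex.conj_im,
    Complex.div_ofReal_re, Complex.div_ofReal_im, Complex.sub_re, Complex.sub_im,
    Complex.ofReal_re, Complex.ofReal_im, Complex.mul_im, Complex.I_re, Complex.I_im,
    Matrix.cons_val_zero, Matrix.cons_val_one, Matrix.cons_val]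
  generalize v₀ 0 = c at *
  generalize v₀ 1 = a at *
  generalize v₀ 2 = b at *
  field_simp
  linear_combination (a * v 2 - b * v 1) * (a * w 2 - b * w 1) * hr2

/-- equality of the two expressions for the hyperkähler
potential of the c-map:
`(4|z⁰|²/r⁰) Im(∑_A conj(χ^A) F_A(χ)) = (1/(r⁰)³) ∑_{A,B} ((x⃗⁰×x⃗^A)·(x⃗⁰×x⃗^B)) Im F_{AB}(χ)`
(components `1,2,3` of the paper are `0,1,2` in `Fin 3`). -/
theorem stmt17 (n : ℕ) (hn : 1 ≤ n) (F : (Fin n → ℂ) → ℂ)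
    (hF : Differentiable ℂ F)
    (hhom : ∀ (t : ℂ) (w : Fin n → ℂ), F (t • w) = t ^ 2 * F w)
    (xv : Fin (n + 1) → Fin 3 → ℝ)
    (x : Fin (n + 1) → ℝ) (hx : ∀ I, x I = xv I 0)
    (z : Fin (n + 1) → ℂ)
    (hz : ∀ I, z I = (1 / 2 : ℂ) * ((xv I 1 : ℂ) + Complex.I * (xv I 2 : ℂ)))
    (hz0 : z 0 ≠ 0)
    (r : ℝ) (hr : r = Real.sqrt (dot3 (xv 0) (xv 0)))
    (ζp : ℂ)
    (hζp : ζp = ((x 0 : ℂ) - (r : ℂ)) / (2 * starRingEnd ℂ (z 0)))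
    (χ : Fin n → ℂ)
    (hχ : ∀ A : Fin n, χ A =
      (z A.succ / ζp + (x A.succ : ℂ) - starRingEnd ℂ (z A.succ) * ζp) / (r : ℂ)) :
    (4 * Complex.normSq (z 0) / r) *
        (∑ A : Fin n, starRingEnd ℂ (χ A) * fderiv ℂ F χ (Pi.single A 1)).im =
      (1 / r ^ 3) * ∑ A : Fin n, ∑ B : Fin n,
        dot3 (cross3 (xv 0) (xv A.succ)) (cross3 (xv 0) (xv B.succ)) *
          (fderiv ℂ (fun w => fderiv ℂ F w (Pi.single A 1)) χ (Pi.single B 1)).im := by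
  have hsymm := fderiv_apply_comm_of_homogeneous_two hF hhom
  set H : Fin n → Fin n → ℂ := fun A B => fderiv ℂ F (Pi.single A 1) (Pi.single B 1) with hH
  have hsecond : ∀ A B, fderiv ℂ (fun w => fderiv ℂ F w (Pi.single A 1)) χ (Pi.single B 1) =
      H A B := by
    intro A B
    have hlin : (fun w => fderiv ℂ F w (Pi.single A 1)) = fderiv ℂ F (Pi.single A 1) :=
      funext fun w => hsymm _ _
    rw [hlin, ContinuousLinearMap.fderiv]
  have hfirst : ∀ A, fderiv ℂ F χ (Pi.single A 1) = ∑ B, χ B * H A B := by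
    intro A
    rw [hsymm]
    conv_lhs => rw [pi_eq_sum_univ' χ]
    simp [map_sum, hH, smul_eq_mul]
  simp_rw [hfirst, hsecond]
  rw [im_sum_conj_mul_sum_of_symm χ H fun A B => hsymm _ _, Finset.mul_sum, Finset.mul_sum]
  refine Finset.sum_congr rfl fun A _ => ?_
  rw [Finset.mul_sum, Finset.mul_sum]
  refine Finset.sum_congr rfl fun B _ => ?_
  rw [← mul_assoc, ← mul_assoc, normSq_mul_re_conj_mul_eq_dot_cross (hz 0) hz0 (hz A.succ)
    (hz B.succ) hr (hx 0 ▸ hζp) (hx A.succ ▸ hχ A) (hx B.succ ▸ hχ B)]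
end
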